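/- Let c ≥ 2 and d ≥ 1 be real constants. There is a constant C > 0 depending only on c and d such that for every n ≥ 3 and every integer m with 1 < m < n/2, the MMAHH with acceptance operators OI and AM on Jump_m with switching probabilities q = 1/(d·m) and p = m·q/(c·n), started from x_0 uniformly distributed on {0,1}^n and s_0 = OI, has runtime T satisfying E[T] ≤ C·(n² + e^{1/d}·n^{m+1}/(m−1)!); in particular E[T] = O(n^{m+1}/(m−1)!). -/

import Mathlib

open MeasureTheory
open scoped ENNReal NNReal

namespace MMAHHStmt

/-- The two acceptance operators. -/
inductive Op : Type
  | OI : Op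
  | AM : Op
  deriving DecidableEq

instance : MeasurableSpace Op := ⊤

/-- Search points: bit-strings of length `n`. -/
abbrev Point (n : ℕ) := Fin n → Bool

/-- The number of one-bits of a bit-string. -/
def ones {n : ℕ} (x : Point n) : ℕ := (Finset.univ.filter fun i => x i = true).card

/-- The all-ones string, the global optimum of all benchmarks considered. -/
def optimum (n : ℕ) : Point n := fun _ => true

/-- Flipping the bit in position `v`. -/
def flipBit {n : ℕ} (x : Point n) (v : Fin n) : Point n := Function.update x v (!(x v))

open Classical in
/-- The search point obtained from `x` by proposing to flip bit `v` and applying the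
acceptance operator `op` for the objective function `f`. -/
noncomputable def movedPoint {n : ℕ} (f : Point n → ℝ) (op : Op) (x : Point n) (v : Fin n) :
    Point n :=
  match op with
  | Op.OI => if f x < f (flipBit x v) then flipBit x v else x
  | Op.AM => flipBit x v

open Classical in
/-- One-step transition probability of the search point under acceptance operator `op`:
a uniformly random bit is flipped and the move is accepted or rejected according to `op`. -/
noncomputable def moveProb {n : ℕ} (f : Point n → ℝ) (op : Op) (x x' : Point n) : ℝ≥0∞ :=
  ((Finset.univ.filter fun v => movedPoint f op x v = x').card : ℝ≥0∞) / n

/-- Transition probabilities of the two-state Markov chain on the acceptance operators. -/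
noncomputable def switchProb (p q : ℝ) : Op → Op → ℝ≥0∞
  | Op.OI, Op.OI => ENNReal.ofReal (1 - p)
  | Op.OI, Op.AM => ENNReal.ofReal p
  | Op.AM, Op.OI => ENNReal.ofReal q
  | Op.AM, Op.AM => ENNReal.ofReal (1 - q)

/-- One-step transition probabilities of the MMAHH on the state space
`Point n × Op`: the search point moves according to the current acceptance operator, and,
independently, the operator switches according to the two-state Markov chain. -/
noncomputable def mmahhTrans {n : ℕ} (f : Point n → ℝ) (p q : ℝ) :
    Point n × Op → Point n × Op → ℝ≥0∞ :=
  fun s s' => moveProb f s.2 s.1 s'.1 * switchProb p q s.2 s'.2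

/-- `X` is (a version of) the MMAHH Markov chain with objective function `f` and switching
probabilities `p` and `q`, under the measure `μ`: each `X t` is measurable, and conditionally
on any history, the next state is distributed according to `mmahhTrans`. -/
def IsMMAHH {n : ℕ} {Ω : Type*} [MeasurableSpace Ω] (μ : Measure Ω)
    (X : ℕ → Ω → Point n × Op) (f : Point n → ℝ) (p q : ℝ) : Prop :=
  (∀ t, Measurable (X t)) ∧
  ∀ (t : ℕ) (σ : ℕ → Point n × Op) (s' : Point n × Op),
    μ {ω | (∀ i ≤ t, X i ω = σ i) ∧ X (t + 1) ω = s'}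
      = μ {ω | ∀ i ≤ t, X i ω = σ i} * mmahhTrans f p q (σ t) s'

/-- The runtime: the first hitting time of the global optimum, as an extended natural number
(`⊤` if the optimum is never reached). -/
noncomputable def hitTime {n : ℕ} {Ω : Type*} (X : ℕ → Ω → Point n × Op) (ω : Ω) : ℕ∞ :=
  ⨅ t ∈ {t : ℕ | (X t ω).1 = optimum n}, (t : ℕ∞)

/-- The `k`-th switching time between the two acceptance operators (with junk value given by
`Nat.sInf ∅ = 0` on the probability-zero event that no further switch occurs). -/
noncomputable def switchTime {n : ℕ} {Ω : Type*} (X : ℕ → Ω → Point n × Op) : ℕ → Ω → ℕ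
  | 0, _ => 0
  | k + 1, ω =>
      sInf {t : ℕ | switchTime X k ω ≤ t ∧ (X t ω).2 ≠ (X (switchTime X k ω) ω).2}

/-- The Jump benchmark with gap parameter `m`. -/
noncomputable def Jump (n m : ℕ) (x : Point n) : ℝ :=
  if ones x ≤ n - m ∨ ones x = n then (m : ℝ) + (ones x : ℝ) else (n : ℝ) - (ones x : ℝ)

/-! ### General supersolution bound for hitting times -/

instance instFintypeOp : Fintype Op := ⟨{Op.OI, Op.AM}, by intro x; cases x <;> decide⟩

instance instDiscOp : DiscreteMeasurableSpace Op := ⟨fun _ => trivial⟩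

lemma sum_op {M : Type*} [AddCommMonoid M] (g : Op → M) : ∑ o, g o = g Op.OI + g Op.AM := by
  change ∑ o ∈ ({Op.OI, Op.AM} : Finset Op), g o = _
  rw [Finset.sum_pair (by decide)]

section General

set_option linter.unusedSectionVars false

variable {n : ℕ} {Ω : Type} [MeasurableSpace Ω] {μ : Measure Ω} {X : ℕ → Ω → Point n × Op}
  {f : Point n → ℝ} {p q : ℝ}

/-- the event of agreeing with history `σ` up to time `t` -/
def Hist (X : ℕ → Ω → Point n × Op) (t : ℕ) (σ : ℕ → Point n × Op) : Set Ω :=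
  {ω | ∀ i ≤ t, X i ω = σ i}

/-- the event that the optimum is not hit up to time `t` -/
def Miss (X : ℕ → Ω → Point n × Op) (t : ℕ) : Set Ω :=
  {ω | ∀ i ≤ t, (X i ω).1 ≠ optimum n}

/-- extension of a finite history -/
def ext (t : ℕ) (σ : Fin (t + 1) → Point n × Op) (i : ℕ) : Point n × Op :=
  if h : i < t + 1 then σ ⟨i, h⟩ else σ 0

lemma meas_hist (hX : ∀ t, Measurable (X t)) (t : ℕ) (σ : ℕ → Point n × Op) :
    MeasurableSet (Hist X t σ) := by
  have : Hist X t σ = ⋂ i, ⋂ (_ : i ≤ t), X i ⁻¹' {σ i} := by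
    ext ω; simp [Hist]
  rw [this]
  exact MeasurableSet.iInter fun i => MeasurableSet.iInter fun _ =>
    hX i (measurableSet_singleton _)

lemma meas_miss (hX : ∀ t, Measurable (X t)) (t : ℕ) : MeasurableSet (Miss X t) := by
  have : Miss X t = ⋂ i, ⋂ (_ : i ≤ t), X i ⁻¹' {s | s.1 ≠ optimum n} := by
    ext ω; simp [Miss]
  rw [this]
  exact MeasurableSet.iInter fun i => MeasurableSet.iInter fun _ =>
    hX i (MeasurableSet.of_discrete)

open Classical in
lemma miss_eq (t : ℕ) : Miss X t =
    ⋃ σ ∈ (Finset.univ.filter fun σ : Fin (t + 1) → Point n × Op => ∀ i, (σ i).1 ≠ optimum n),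
      Hist X t (ext t σ) := by
  ext ω
  simp only [Miss, Hist, Set.mem_ofPred_eq, Set.mem_iUnion, Finset.mem_filter, Finset.mem_univ,
    true_and, exists_prop]
  constructor
  · intro h
    refine ⟨fun i => X i ω, fun i => h i (by omega), fun i hi => ?_⟩
    simp [ext, Nat.lt_succ_of_le hi]
  · rintro ⟨σ, h1, h2⟩ i hi
    rw [h2 i hi]
    simp only [ext, Nat.lt_succ_of_le hi, dif_pos]
    exact h1 _

lemma hist_disj (t : ℕ) : Pairwise fun σ τ : Fin (t + 1) → Point n × Op =>
    Disjoint (Hist X t (ext t σ)) (Hist X t (ext t τ)) := by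
  intro σ τ hne
  rw [Set.disjoint_left]
  intro ω h1 h2
  apply hne
  funext i
  have a := h1 i (by omega)
  have b := h2 i (by omega)
  rw [a] at b
  simpa only [ext, i.isLt, dif_pos] using b

lemma lint_hist (hX : ∀ t, Measurable (X t)) (A : Set Ω) (t : ℕ)
    (V : Point n × Op → ℝ≥0∞) :
    ∫⁻ ω in A, V (X t ω) ∂μ = ∑ s, V s * μ ({ω | X t ω = s} ∩ A) := by
  have h1 : ∫⁻ ω in A, V (X t ω) ∂μ = ∫⁻ s, V s ∂((μ.restrict A).map (X t)) :=
    (lintegral_map (Measurable.of_discrete) (hX t)).symm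
  rw [h1, lintegral_fintype]
  refine Finset.sum_congr rfl fun s _ => ?_
  rw [Measure.map_apply (hX t) (measurableSet_singleton _),
    Measure.restrict_apply (hX t (measurableSet_singleton _))]
  rfl

lemma step_hist (hM : IsMMAHH μ X f p q) (V : Point n × Op → ℝ≥0∞)
    (hV : ∀ s : Point n × Op, s.1 ≠ optimum n → 1 + ∑ s', mmahhTrans f p q s s' * V s' ≤ V s)
    (t : ℕ) (σ : ℕ → Point n × Op) (hσ : (σ t).1 ≠ optimum n) :
    μ (Hist X t σ) + ∫⁻ ω in Hist X t σ, V (X (t + 1) ω) ∂μ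
      ≤ ∫⁻ ω in Hist X t σ, V (X t ω) ∂μ := by
  have h2 : ∫⁻ ω in Hist X t σ, V (X t ω) ∂μ = V (σ t) * μ (Hist X t σ) := by
    rw [← setLIntegral_const]
    refine setLIntegral_congr_fun (meas_hist hM.1 t σ) ?_
    intro ω hω
    simp only
    rw [hω t le_rfl]
  rw [h2, lint_hist hM.1]
  have h3 : ∀ s', μ ({ω | X (t + 1) ω = s'} ∩ Hist X t σ)
      = μ (Hist X t σ) * mmahhTrans f p q (σ t) s' := by
    intro s'
    have := hM.2 t σ s'
    rw [Hist, ← this]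
    congr 1
    ext ω
    simp only [Set.mem_inter_iff, Set.mem_ofPred_eq]
    tauto
  simp_rw [h3]
  calc μ (Hist X t σ) + ∑ s', V s' * (μ (Hist X t σ) * mmahhTrans f p q (σ t) s')
      = (1 + ∑ s', mmahhTrans f p q (σ t) s' * V s') * μ (Hist X t σ) := by
        rw [add_mul, one_mul, Finset.sum_mul]
        congr 1
        exact Finset.sum_congr rfl fun _ _ => by ring
    _ ≤ _ := by gcongr; exact hV _ hσ

lemma step_miss (hM : IsMMAHH μ X f p q) (V : Point n × Op → ℝ≥0∞)
    (hV : ∀ s : Point n × Op, s.1 ≠ optimum n → 1 + ∑ s', mmahhTrans f p q s s' * V s' ≤ V s)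
    (t : ℕ) :
    μ (Miss X t) + ∫⁻ ω in Miss X t, V (X (t + 1) ω) ∂μ ≤ ∫⁻ ω in Miss X t, V (X t ω) ∂μ := by
  classical
  have hm : ∀ σ ∈ (Finset.univ.filter
      fun σ : Fin (t + 1) → Point n × Op => ∀ i, (σ i).1 ≠ optimum n),
      MeasurableSet (Hist X t (ext t σ)) := fun σ _ => meas_hist hM.1 t _
  have hd : Set.PairwiseDisjoint (↑(Finset.univ.filter
      fun σ : Fin (t + 1) → Point n × Op => ∀ i, (σ i).1 ≠ optimum n))
      (fun σ => Hist X t (ext t σ)) := fun σ _ τ _ h => hist_disj t h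
  rw [miss_eq, measure_biUnion_finset hd hm, lintegral_biUnion_finset hd hm,
    lintegral_biUnion_finset hd hm, ← Finset.sum_add_distrib]
  refine Finset.sum_le_sum fun σ hσ => ?_
  refine step_hist hM V hV t _ ?_
  simp only [Finset.mem_filter, Finset.mem_univ, true_and] at hσ
  simp only [ext, Nat.lt_succ_self, dif_pos]
  exact hσ _

lemma sum_miss (hM : IsMMAHH μ X f p q) (V : Point n × Op → ℝ≥0∞)
    (hV : ∀ s : Point n × Op, s.1 ≠ optimum n → 1 + ∑ s', mmahhTrans f p q s s' * V s' ≤ V s)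
    (t : ℕ) :
    ∑ i ∈ Finset.range t, μ (Miss X i) + ∫⁻ ω in Miss X t, V (X t ω) ∂μ
      ≤ ∫⁻ ω, V (X 0 ω) ∂μ := by
  induction t with
  | zero => simpa using setLIntegral_le_lintegral _ _
  | succ t ih =>
    refine le_trans ?_ ih
    rw [Finset.sum_range_succ, add_assoc]
    gcongr
    refine le_trans ?_ (step_miss hM V hV t)
    gcongr
    intro ω h i hi
    exact h i (by omega)

lemma hit_eq (ω : Ω) : (hitTime X ω : ℝ≥0∞) ≤ ∑' t, (Miss X t).indicator 1 ω := by
  by_cases h : ∃ t, (X t ω).1 = optimum n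
  · classical
    have h1 : hitTime X ω ≤ (Nat.find h : ℕ∞) := by
      unfold hitTime
      exact iInf₂_le (f := fun (t : ℕ) (_ : t ∈ {t : ℕ | (X t ω).1 = optimum n}) => (t : ℕ∞))
        (Nat.find h) (Nat.find_spec h)
    calc (hitTime X ω : ℝ≥0∞) ≤ ((Nat.find h : ℕ∞) : ℝ≥0∞) := by exact_mod_cast h1
      _ = ∑ t ∈ Finset.range (Nat.find h), (1 : ℝ≥0∞) := by simp
      _ = ∑ t ∈ Finset.range (Nat.find h), (Miss X t).indicator 1 ω := by
        refine Finset.sum_congr rfl fun t ht => ?_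
        rw [Set.indicator_of_mem]; · rfl
        intro i hi
        exact Nat.find_min h (by have := Finset.mem_range.1 ht; omega)
      _ ≤ _ := ENNReal.sum_le_tsum _
  · push Not at h
    have : ∀ t, (Miss X t).indicator (1 : Ω → ℝ≥0∞) ω = 1 := fun t => by
      rw [Set.indicator_of_mem]; · rfl
      intro i _; exact h i
    simp_rw [this]
    rw [ENNReal.tsum_const_eq_top_of_ne_zero one_ne_zero]
    exact le_top

lemma hit_bound [IsProbabilityMeasure μ] (hM : IsMMAHH μ X f p q) (V : Point n × Op → ℝ≥0∞)
    (hV : ∀ s : Point n × Op, s.1 ≠ optimum n → 1 + ∑ s', mmahhTrans f p q s s' * V s' ≤ V s)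
    (B : ℝ≥0∞) (hB : ∀ s, V s ≤ B) :
    ∫⁻ ω, (hitTime X ω : ℝ≥0∞) ∂μ ≤ B := by
  calc ∫⁻ ω, (hitTime X ω : ℝ≥0∞) ∂μ ≤ ∫⁻ ω, ∑' t, (Miss X t).indicator 1 ω ∂μ :=
        lintegral_mono fun ω => hit_eq ω
    _ = ∑' t, μ (Miss X t) := by
        rw [lintegral_tsum fun t =>
          ((measurable_one.indicator (meas_miss hM.1 t)).aemeasurable)]
        simp_rw [lintegral_indicator_one (meas_miss hM.1 _)]
    _ ≤ B := by
        rw [ENNReal.tsum_eq_iSup_nat]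
        refine iSup_le fun t => ?_
        refine le_trans le_self_add ((sum_miss hM V hV t).trans ?_)
        calc ∫⁻ ω, V (X 0 ω) ∂μ ≤ ∫⁻ _, B ∂μ := lintegral_mono fun ω => hB _
          _ = B := by simp

/-- real transition probabilities of the operator chain -/
def sw (p q : ℝ) : Op → Op → ℝ
  | Op.OI, Op.OI => 1 - p
  | Op.OI, Op.AM => p
  | Op.AM, Op.OI => q
  | Op.AM, Op.AM => 1 - q

lemma trans_bound (hn : 0 < n) (hp0 : 0 ≤ p) (hp1 : p ≤ 1) (hq0 : 0 ≤ q) (hq1 : q ≤ 1)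
    (v : Point n × Op → ℝ) (hv : ∀ s, 0 ≤ v s) (s : Point n × Op)
    (h : n + ∑ w, (sw p q s.2 Op.OI * v (movedPoint f s.2 s.1 w, Op.OI)
      + sw p q s.2 Op.AM * v (movedPoint f s.2 s.1 w, Op.AM)) ≤ n * v s) :
    1 + ∑ s', mmahhTrans f p q s s' * ENNReal.ofReal (v s') ≤ ENNReal.ofReal (v s) := by
  classical
  have hsw : ∀ o o', switchProb p q o o' = ENNReal.ofReal (sw p q o o') := by
    intro o o'; cases o <;> cases o' <;> rfl
  have hsw0 : ∀ o o', 0 ≤ sw p q o o' := by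
    intro o o'; cases o <;> cases o' <;> simp [sw] <;> linarith
  have hn' : (0 : ℝ) < n := by exact_mod_cast hn
  set g : Point n → ℝ := fun x' => sw p q s.2 Op.OI * v (x', Op.OI)
      + sw p q s.2 Op.AM * v (x', Op.AM) with hg
  have hg0 : ∀ x', 0 ≤ g x' := fun x' =>
    add_nonneg (mul_nonneg (hsw0 _ _) (hv _)) (mul_nonneg (hsw0 _ _) (hv _))
  have e1 : ∑ s', mmahhTrans f p q s s' * ENNReal.ofReal (v s')
      = ENNReal.ofReal ((∑ w, g (movedPoint f s.2 s.1 w)) / n) := by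
    rw [Fintype.sum_prod_type]
    have e2 : ∀ x', ∑ o, mmahhTrans f p q s (x', o) * ENNReal.ofReal (v (x', o))
        = ENNReal.ofReal (((Finset.univ.filter
            fun w => movedPoint f s.2 s.1 w = x').card : ℝ) / n * g x') := by
      intro x'
      have e3 : moveProb f s.2 s.1 x' = ENNReal.ofReal (((Finset.univ.filter
            fun w => movedPoint f s.2 s.1 w = x').card : ℝ) / n) := by
        rw [ENNReal.ofReal_div_of_pos hn', ENNReal.ofReal_natCast, ENNReal.ofReal_natCast]
        unfold moveProb
        congr!
      rw [sum_op]
      simp only [mmahhTrans, e3, hsw]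
      rw [mul_assoc, mul_assoc, ← mul_add, ← ENNReal.ofReal_mul (hsw0 _ _),
        ← ENNReal.ofReal_mul (hsw0 _ _), ← ENNReal.ofReal_add
          (mul_nonneg (hsw0 _ _) (hv _)) (mul_nonneg (hsw0 _ _) (hv _)),
        ← ENNReal.ofReal_mul (by positivity)]
    simp_rw [e2]
    rw [← ENNReal.ofReal_sum_of_nonneg
      (fun x' _ => mul_nonneg (by positivity) (hg0 x'))]
    congr 1
    have e4 := Finset.sum_comp g (movedPoint f s.2 s.1) (s := Finset.univ)
    rw [Finset.sum_div]
    rw [← Finset.sum_fiberwise (s := Finset.univ) (g := movedPoint f s.2 s.1)]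
    refine Finset.sum_congr rfl fun x' _ => ?_
    rw [Finset.sum_congr rfl (g := fun _ => g x' / n)]
    · rw [Finset.sum_const, nsmul_eq_mul]; ring
    · intro w hw
      rw [(Finset.mem_filter.1 hw).2]
  rw [e1, ← ENNReal.ofReal_one, ← ENNReal.ofReal_add zero_le_one
    (div_nonneg (Finset.sum_nonneg fun w _ => hg0 _) hn'.le)]
  apply ENNReal.ofReal_le_ofReal
  have : 1 + (∑ w, g (movedPoint f s.2 s.1 w)) / n
      = (n + ∑ w, g (movedPoint f s.2 s.1 w)) / n := by field_simp
  rw [this, div_le_iff₀ hn']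
  linarith

end General

/-! ### The potential function -/

/-- number of zero bits -/
def zeros {n : ℕ} (x : Point n) : ℕ := (Finset.univ.filter fun i => x i = false).card

lemma ones_add_zeros {n : ℕ} (x : Point n) : ones x + zeros x = n := by
  have := Finset.card_filter_add_card_filter_not (s := (Finset.univ : Finset (Fin n)))
    (fun i => x i = true)
  simp only [Bool.not_eq_true, Finset.card_univ, Fintype.card_fin] at this
  exact this

lemma zeros_pos {n : ℕ} (x : Point n) (h : x ≠ optimum n) : 0 < zeros x := by
  rw [zeros, Finset.card_pos]
  by_contra hh
  apply h
  funext i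
  rw [Finset.not_nonempty_iff_eq_empty] at hh
  have := Finset.filter_eq_empty_iff.1 hh (Finset.mem_univ i)
  simpa [optimum] using this

lemma flip_zero {n : ℕ} (x : Point n) (w : Fin n) (h : x w = false) :
    zeros (flipBit x w) + 1 = zeros x := by
  have : (Finset.univ.filter fun i => x i = false)
      = insert w (Finset.univ.filter fun i => flipBit x w i = false) := by
    ext i
    by_cases hi : i = w
    · subst hi; simp [h]
    · have e : flipBit x w i = x i := Function.update_of_ne hi _ _
      rw [Finset.mem_insert, Finset.mem_filter, Finset.mem_filter, e]
      simp [hi]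
  rw [zeros, zeros, this, Finset.card_insert_of_notMem]
  simp [flipBit, h]

lemma flip_one {n : ℕ} (x : Point n) (w : Fin n) (h : x w = true) :
    zeros (flipBit x w) = zeros x + 1 := by
  have := flip_zero (flipBit x w) w (by simp [flipBit, h])
  have e : flipBit (flipBit x w) w = x := by simp [flipBit]
  rw [e] at this
  exact this.symm

lemma sum_bits {n : ℕ} (x : Point n) (a b : ℝ) :
    ∑ w, (if x w = false then a else b) = zeros x * a + (n - zeros x) * b := by
  have h := ones_add_zeros x
  have h' : (n : ℝ) = ones x + zeros x := by exact_mod_cast h.symm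
  rw [Finset.sum_ite, Finset.sum_const, Finset.sum_const, nsmul_eq_mul, nsmul_eq_mul, h']
  simp [zeros, ones]

/-- direct descent probability -/
noncomputable def hh (n m : ℕ) (q : ℝ) (y : ℕ) : ℝ :=
  if y ≤ m then (1 - q) ^ y * y.factorial / n ^ y else 0

/-- the potential -/
noncomputable def pot (n m : ℕ) (q W α β : ℝ) (s : Point n × Op) : ℝ :=
  match s.2 with
  | Op.OI => W + α * |(zeros s.1 : ℝ) - m|
  | Op.AM => W * (1 - hh n m q (zeros s.1)) + α * |(zeros s.1 : ℝ) - m| + β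

lemma hh_nonneg (n m : ℕ) (q : ℝ) (hq1 : q ≤ 1) (y : ℕ) : 0 ≤ hh n m q y := by
  unfold hh
  have : 0 ≤ 1 - q := by linarith
  split_ifs <;> positivity

lemma hh_le_one (n m : ℕ) (q : ℝ) (hq0 : 0 ≤ q) (hq1 : q ≤ 1) (hmn : m ≤ n) (y : ℕ) :
    hh n m q y ≤ 1 := by
  unfold hh
  have h0 : 0 ≤ 1 - q := by linarith
  split_ifs with hy
  · have h1 : (1 - q) ^ y ≤ 1 := pow_le_one₀ h0 (by linarith)
    have h2 : (y.factorial : ℝ) ≤ (n : ℝ) ^ y := by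
      have := (Nat.factorial_le_pow y).trans (Nat.pow_le_pow_left (hy.trans hmn) y)
      exact_mod_cast this
    apply div_le_one_of_le₀ _ (by positivity)
    calc (1 - q) ^ y * y.factorial ≤ 1 * n ^ y := by gcongr
      _ = _ := one_mul _
  · exact zero_le_one

lemma hh_succ (n m : ℕ) (hn : 0 < n) (q : ℝ) (y : ℕ) (hy : y + 1 ≤ m) :
    (y + 1) * ((1 - q) * hh n m q y) = n * hh n m q (y + 1) := by
  unfold hh
  rw [if_pos hy, if_pos (by omega), Nat.factorial_succ]
  push_cast
  field_simp
  ring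

lemma abs_flip {n : ℕ} (x : Point n) (w : Fin n) (m : ℕ) :
    |(zeros (flipBit x w) : ℝ) - m| ≤ |(zeros x : ℝ) - m| + 1 := by
  cases h : x w
  · have := flip_zero x w h
    rw [← this]; push_cast
    have := abs_sub_abs_le_abs_sub ((zeros (flipBit x w) : ℝ) - m)
      ((zeros (flipBit x w) : ℝ) + 1 - m)
    have e : ((zeros (flipBit x w) : ℝ) - m) - ((zeros (flipBit x w) : ℝ) + 1 - m) = -1 := by ring
    rw [e] at this
    norm_num at this
    linarith
  · have := flip_one x w h
    rw [this]; push_cast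
    have := abs_sub_abs_le_abs_sub ((zeros x : ℝ) + 1 - m) ((zeros x : ℝ) - m)
    have e : ((zeros x : ℝ) + 1 - m) - ((zeros x : ℝ) - m) = 1 := by ring
    rw [e] at this
    norm_num at this
    linarith

lemma step_AM (n m : ℕ) (hn : 0 < n) (p q W α β : ℝ) (hq1 : q ≤ 1)
    (hW : 0 ≤ W) (hα : 0 ≤ α) (hβ : q * β = 1 + α) (f : Point n → ℝ) (x : Point n)
    (hx : x ≠ optimum n) :
    n + ∑ w, (sw p q Op.AM Op.OI * pot n m q W α β (movedPoint f Op.AM x w, Op.OI)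
      + sw p q Op.AM Op.AM * pot n m q W α β (movedPoint f Op.AM x w, Op.AM))
      ≤ n * pot n m q W α β (x, Op.AM) := by
  have hz := zeros_pos x hx
  have hzn : (zeros x : ℝ) ≤ n := by
    have := ones_add_zeros x
    exact_mod_cast (by omega : zeros x ≤ n)
  simp only [sw, pot, movedPoint]
  set k := (1 - q) * (if zeros x ≤ m then hh n m q (zeros x - 1) else 0) with hk
  have h1 : ∀ w, q * (W + α * |(zeros (flipBit x w) : ℝ) - m|)
      + (1 - q) * (W * (1 - hh n m q (zeros (flipBit x w)))
        + α * |(zeros (flipBit x w) : ℝ) - m| + β)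
      ≤ (if x w = false then W + α * |(zeros x : ℝ) - m| + β - 1 - W * k
          else W + α * |(zeros x : ℝ) - m| + β - 1) := by
    intro w
    have h2 := mul_le_mul_of_nonneg_left (abs_flip x w m) hα
    have h3 : 0 ≤ (1 - q) * hh n m q (zeros (flipBit x w)) :=
      mul_nonneg (by linarith) (hh_nonneg n m q hq1 _)
    split_ifs with hw
    · have h4 : k ≤ (1 - q) * hh n m q (zeros (flipBit x w)) := by
        rw [hk]
        split_ifs
        · have := flip_zero x w hw
          rw [← this]; simp
        · simpa using h3
      have h5 := mul_le_mul_of_nonneg_left h4 hW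
      nlinarith
    · have h5 := mul_nonneg hW h3
      nlinarith
  have h6 : n * hh n m q (zeros x) ≤ zeros x * k := by
    rw [hk]
    split_ifs with hy
    · obtain ⟨y, hy'⟩ := Nat.exists_eq_succ_of_ne_zero hz.ne'
      rw [hy'] at hy ⊢
      have := hh_succ n m hn q y hy
      simp only [Nat.succ_eq_add_one, Nat.add_sub_cancel, Nat.cast_add, Nat.cast_one]
      rw [this]
    · simp [hh, hy]
  have h7 := Finset.sum_le_sum (s := Finset.univ) fun w _ => h1 w
  rw [sum_bits] at h7
  have h8 := mul_le_mul_of_nonneg_left h6 hW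
  nlinarith

lemma step_OI_avg (n m : ℕ) (p q W α β : ℝ) (hp0 : 0 ≤ p) (hq1 : q ≤ 1) (hW : 0 ≤ W)
    (x : Point n) :
    sw p q Op.OI Op.OI * pot n m q W α β (x, Op.OI)
      + sw p q Op.OI Op.AM * pot n m q W α β (x, Op.AM)
      ≤ W + α * |(zeros x : ℝ) - m| + p * β := by
  simp only [sw, pot]
  have := mul_nonneg hp0 (mul_nonneg hW (hh_nonneg n m q hq1 (zeros x)))
  nlinarith

/-- the acceptance decision in `OI` mode -/
lemma jump_lt (n m : ℕ) (hm : 1 < m) (hmn : 2 * m < n) (x : Point n)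
    (hz : 0 < zeros x) (w : Fin n) :
    Jump n m x < Jump n m (flipBit x w) ↔
      ((x w = false ∧ (m < zeros x ∨ zeros x = 1)) ∨ (x w = true ∧ zeros x < m)) := by
  have h1 := ones_add_zeros x
  have h2 := ones_add_zeros (flipBit x w)
  have h3 : (n : ℝ) = ones x + zeros x := by exact_mod_cast h1.symm
  have h4 : (n : ℝ) = ones (flipBit x w) + zeros (flipBit x w) := by exact_mod_cast h2.symm
  unfold Jump
  cases h : x w
  · have h5 := flip_zero x w h
    have e : (ones (flipBit x w) : ℝ) = ones x + 1 := by
      exact_mod_cast (by omega : ones (flipBit x w) = ones x + 1)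
    have hm' : (1 : ℝ) < m := by exact_mod_cast hm
    have hc0 : zeros x ≤ m → (zeros x : ℝ) ≤ m := fun h => by exact_mod_cast h
    have hz0 : (1 : ℝ) ≤ zeros x := by exact_mod_cast (by omega : 1 ≤ zeros x)
    simp only [true_and, false_and, or_false, reduceCtorEq]
    constructor
    · intro hlt
      by_contra hc
      push Not at hc
      rw [if_neg (by omega : ¬ (ones (flipBit x w) ≤ n - m ∨ ones (flipBit x w) = n))] at hlt
      have hc1 := hc0 hc.1
      split_ifs at hlt <;> linarith
    · rintro (hc | hc)
      · rw [if_pos (by omega), if_pos (by omega), e]; linarith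
      · have : (zeros x : ℝ) = 1 := by exact_mod_cast hc
        have : (0 : ℝ) ≤ ones x := by positivity
        rw [if_neg (by omega), if_pos (by omega), e]; linarith
  · have h5 := flip_one x w h
    have e : (ones x : ℝ) = ones (flipBit x w) + 1 := by
      exact_mod_cast (by omega : ones x = ones (flipBit x w) + 1)
    have hm' : (1 : ℝ) < m := by exact_mod_cast hm
    simp only [true_and, false_and, false_or, reduceCtorEq]
    constructor
    · intro hlt
      by_contra hc
      push Not at hc
      rw [if_pos (by omega), if_pos (by omega)] at hlt
      linarith
    · intro hc
      have hc' : (zeros x : ℝ) + 1 ≤ m := by exact_mod_cast hc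
      have : (0 : ℝ) ≤ ones (flipBit x w) := by positivity
      rw [if_neg (by omega)]
      split_ifs
      · linarith
      · linarith

lemma step_OI (n m : ℕ) (hm : 1 < m) (hmn : 2 * m < n) (p q W α β : ℝ) (hp0 : 0 ≤ p)
    (hq1 : q ≤ 1) (hW : 0 ≤ W) (hα : 0 ≤ α) (hαm : α * m = 3 * n) (hpβ : p * β ≤ 7 / 4)
    (hWh : 1 + p * β ≤ p * (W * hh n m q m)) (x : Point n) (hx : x ≠ optimum n) :
    n + ∑ w, (sw p q Op.OI Op.OI * pot n m q W α β (movedPoint (Jump n m) Op.OI x w, Op.OI)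
      + sw p q Op.OI Op.AM * pot n m q W α β (movedPoint (Jump n m) Op.OI x w, Op.AM))
      ≤ n * pot n m q W α β (x, Op.OI) := by
  have hz := zeros_pos x hx
  have hzn : (zeros x : ℝ) ≤ n := by
    have := ones_add_zeros x
    exact_mod_cast (by omega : zeros x ≤ n)
  have hj := jump_lt n m hm hmn x hz
  have hn0 : (0 : ℝ) ≤ n := by positivity
  by_cases hy : zeros x = m
  · have hst : ∀ w, movedPoint (Jump n m) Op.OI x w = x := by
      intro w
      simp only [movedPoint]
      rw [if_neg]
      rw [hj w]
      omega
    simp_rw [hst]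
    simp only [sw, pot, hy, Finset.sum_const, Finset.card_univ, Fintype.card_fin, nsmul_eq_mul,
      sub_self, abs_zero, mul_zero, add_zero]
    nlinarith
  · -- it suffices to bound the distance
    suffices hs : ∑ w, |(zeros (movedPoint (Jump n m) Op.OI x w) : ℝ) - m|
        ≤ n * |(zeros x : ℝ) - m| - m by
      have h1 := Finset.sum_le_sum (s := Finset.univ) fun w _ =>
        step_OI_avg n m p q W α β hp0 hq1 hW (movedPoint (Jump n m) Op.OI x w)
      refine le_trans (add_le_add_right h1 _) ?_
      rw [Finset.sum_add_distrib, Finset.sum_add_distrib, ← Finset.mul_sum]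
      simp only [Finset.sum_const, Finset.card_univ, Fintype.card_fin, nsmul_eq_mul, pot]
      have h2 := mul_le_mul_of_nonneg_left hs hα
      nlinarith
    have hm1 : (1 : ℝ) < m := by exact_mod_cast hm
    have hmn' : 2 * (m : ℝ) + 1 ≤ n := by exact_mod_cast hmn
    rcases Nat.lt_or_gt_of_ne hy with hlt | hgt
    · have hlt' : (zeros x : ℝ) + 1 ≤ m := by exact_mod_cast hlt
      have hb : ∀ w, |(zeros (movedPoint (Jump n m) Op.OI x w) : ℝ) - m| ≤
          (if x w = false then (m - zeros x : ℝ) + (if zeros x = 1 then (1 : ℝ) else 0)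
            else (m - zeros x : ℝ) - 1) := by
        intro w
        simp only [movedPoint]
        by_cases hw : x w = false
        · rw [if_pos hw]
          by_cases h1 : zeros x = 1
          · have := abs_flip x w m
            rw [abs_of_nonpos (by linarith : (zeros x : ℝ) - m ≤ 0)] at this
            rw [if_pos ((hj w).2 (Or.inl ⟨hw, Or.inr h1⟩)), if_pos h1]
            linarith
          · rw [if_neg, if_neg h1, abs_of_nonpos (by linarith)]
            · linarith
            · rw [hj w]
              simp [hw, h1]; omega
        · have hw' : x w = true := by simpa using hw
          rw [if_neg hw, if_pos ((hj w).2 (Or.inr ⟨hw', hlt⟩)), flip_one x w hw']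
          push_cast
          rw [abs_of_nonpos (by linarith)]
          linarith
      refine (Finset.sum_le_sum fun w _ => hb w).trans ?_
      rw [sum_bits, abs_of_nonpos (by linarith)]
      split_ifs with h1
      · have : (zeros x : ℝ) = 1 := by exact_mod_cast h1
        rw [this]
        nlinarith
      · nlinarith
    · have hgt' : (m : ℝ) + 1 ≤ zeros x := by exact_mod_cast hgt
      have hb : ∀ w, |(zeros (movedPoint (Jump n m) Op.OI x w) : ℝ) - m| ≤
          (if x w = false then (zeros x - m - 1 : ℝ) else (zeros x - m : ℝ)) := by
        intro w
        simp only [movedPoint]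
        by_cases hw : x w = false
        · have h5 := flip_zero x w hw
          have h6 : (zeros (flipBit x w) : ℝ) + 1 = zeros x := by exact_mod_cast h5
          rw [if_pos hw, if_pos ((hj w).2 (Or.inl ⟨hw, Or.inl hgt⟩)),
            abs_of_nonneg (by linarith)]
          linarith
        · rw [if_neg hw, if_neg, abs_of_nonneg (by linarith)]
          rw [hj w]
          simp [hw]; omega
      refine (Finset.sum_le_sum fun w _ => hb w).trans ?_
      rw [sum_bits, abs_of_nonneg (by linarith)]
      nlinarith

lemma pow_lower (m : ℕ) (hm : 1 < m) (d : ℝ) (hd : 1 ≤ d) :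
    Real.exp (-2) ≤ (1 - 1 / (d * m)) ^ m := by
  have hm' : (2 : ℝ) ≤ m := by exact_mod_cast hm
  have hdm : 2 ≤ d * m := by nlinarith
  set q := 1 / (d * m) with hq
  have hq2 : q ≤ 1 / 2 := one_div_le_one_div_of_le (by norm_num) hdm
  have hq0 : 0 < q := by positivity
  have hqm : q * m ≤ 1 := by
    rw [hq, div_mul_eq_mul_div, div_le_one (by linarith)]; nlinarith
  have h1 : Real.exp (-(2 * q)) ≤ 1 - q := by
    rw [Real.exp_neg, inv_le_comm₀ (Real.exp_pos _) (by linarith)]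
    have := Real.add_one_le_exp (2 * q)
    refine le_trans ?_ this
    rw [inv_le_iff_one_le_mul₀ (by linarith)]
    nlinarith
  calc Real.exp (-2) ≤ Real.exp (m * (-(2 * q))) := by
        apply Real.exp_le_exp.2; nlinarith
    _ = Real.exp (-(2 * q)) ^ m := Real.exp_nat_mul _ _
    _ ≤ _ := pow_le_pow_left₀ (Real.exp_pos _).le h1 m

set_option maxHeartbeats 1000000 in
lemma main_bound (c d : ℝ) (hc : 2 ≤ c) (hd : 1 ≤ d) (n m : ℕ) (hm : 1 < m) (hmn : 2 * m < n)
    (Ω : Type) [MeasurableSpace Ω] (μ : Measure Ω) (X : ℕ → Ω → Point n × Op)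
    (hμ : IsProbabilityMeasure μ)
    (hM : IsMMAHH μ X (Jump n m) ((m : ℝ) * (1 / (d * (m : ℝ))) / (c * (n : ℝ)))
            (1 / (d * (m : ℝ)))) :
    ∫⁻ ω, (hitTime X ω : ℝ≥0∞) ∂μ ≤
      ENNReal.ofReal ((Real.exp 2 * (d * (4 + c)) + 3 + 4 * d) *
        ((n : ℝ) ^ (m + 1) / ((m - 1).factorial : ℝ))) := by
  have hm' : (2 : ℝ) ≤ m := by exact_mod_cast hm
  have hn' : 2 * (m : ℝ) + 1 ≤ n := by exact_mod_cast hmn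
  have hn0 : (0 : ℝ) < n := by linarith
  have hdm : 2 ≤ d * m := by nlinarith
  set q := 1 / (d * (m : ℝ)) with hq
  set p := (m : ℝ) * q / (c * (n : ℝ)) with hp
  have hq2 : q ≤ 1 / 2 := one_div_le_one_div_of_le (by norm_num) hdm
  have hq0 : 0 < q := by positivity
  have hpe : p = 1 / (d * c * n) := by
    rw [hp, hq]; field_simp
  have hp0 : 0 < p := by rw [hpe]; positivity
  have hp1 : p ≤ 1 := by
    rw [hpe, div_le_one (by positivity)]
    have : 2 ≤ d * c := by nlinarith
    nlinarith
  set α : ℝ := 3 * n / m with hα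
  have hα0 : 0 < α := by positivity
  have hαm : α * m = 3 * n := by rw [hα]; field_simp
  set β : ℝ := d * m * (1 + α) with hβ
  have hβ0 : 0 < β := by positivity
  have hβe : β = d * (m + 3 * n) := by rw [hβ, ← hαm]; ring
  have hqβ : q * β = 1 + α := by rw [hβ, hq]; field_simp
  have hpβ : p * β ≤ 7 / 4 := by
    rw [hpe, hβe, div_mul_eq_mul_div, div_le_iff₀ (by positivity)]
    have h1 : 1 * (d * (m + 3 * n)) ≤ d * (7 / 2 * n) := by
      rw [one_mul]; gcongr; linarith
    have h2 : d * (2 * n) ≤ d * (c * n) := by gcongr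
    nlinarith
  set W : ℝ := Real.exp 2 * (d * (4 + c)) * n * (n ^ m / m.factorial) with hW
  have hW0 : 0 ≤ W := by positivity
  have hWh1 : d * (4 + c) * n ≤ W * hh n m q m := by
    have e : W * hh n m q m = (Real.exp 2 * (1 - q) ^ m) * (d * (4 + c) * n) := by
      rw [hW, hh, if_pos le_rfl]
      have : (m.factorial : ℝ) ≠ 0 := by exact_mod_cast m.factorial_ne_zero
      field_simp
    have h1 : 1 ≤ Real.exp 2 * (1 - q) ^ m := by
      have := mul_le_mul_of_nonneg_left (pow_lower m hm d hd) (Real.exp_pos 2).le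
      rwa [← Real.exp_add, add_neg_cancel, Real.exp_zero] at this
    rw [e]
    have : 0 ≤ d * (4 + c) * n := by positivity
    nlinarith
  have hWh : 1 + p * β ≤ p * (W * hh n m q m) := by
    have h1 : d * c * n + β ≤ W * hh n m q m := by
      refine le_trans ?_ hWh1
      rw [hβe]
      nlinarith
    have h2 := mul_le_mul_of_nonneg_left h1 hp0.le
    have h3 : p * (d * c * n) = 1 := by rw [hpe]; field_simp
    rw [mul_add, h3] at h2
    exact h2
  have hmn2 : m ≤ n := by omega
  have hpot0 : ∀ s, 0 ≤ pot n m q W α β s := by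
    rintro ⟨x, o⟩
    cases o
    · simp only [pot]; positivity
    · simp only [pot]
      have := hh_le_one n m q hq0.le (by linarith) hmn2 (zeros x)
      have : 0 ≤ 1 - hh n m q (zeros x) := by linarith
      positivity
  have hpotB : ∀ s, pot n m q W α β s ≤ W + α * n + β := by
    rintro ⟨x, o⟩
    have hzn : (zeros x : ℝ) ≤ n := by
      have := ones_add_zeros x
      exact_mod_cast (by omega : zeros x ≤ n)
    have hz0 : (0 : ℝ) ≤ zeros x := by positivity
    have habs : |(zeros x : ℝ) - m| ≤ n := by
      rw [abs_le]; constructor <;> linarith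
    have h1 := mul_le_mul_of_nonneg_left habs hα0.le
    cases o
    · simp only [pot]; linarith
    · simp only [pot]
      have := mul_nonneg hW0 (hh_nonneg n m q (by linarith) (zeros x))
      linarith
  refine (hit_bound hM (fun s => ENNReal.ofReal (pot n m q W α β s)) ?_ _
    (fun s => ENNReal.ofReal_le_ofReal (hpotB s))).trans (ENNReal.ofReal_le_ofReal ?_)
  · rintro ⟨x, o⟩ hx
    apply trans_bound (by omega) hp0.le hp1 hq0.le (by linarith) _ hpot0
    cases o
    · exact step_OI n m hm hmn p q W α β hp0.le (by linarith) hW0 hα0.le hαm hpβ hWh x hx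
    · exact step_AM n m (by omega) p q W α β (by linarith) hW0 hα0.le hqβ _ x hx
  · set Y : ℝ := (n : ℝ) ^ (m + 1) / ((m - 1).factorial : ℝ) with hY
    have hf : ((m - 1).factorial : ℝ) ≤ (n : ℝ) ^ (m - 1) := by
      have := (Nat.factorial_le_pow (m - 1)).trans
        (Nat.pow_le_pow_left (by omega : m - 1 ≤ n) (m - 1))
      exact_mod_cast this
    have hf0 : (0 : ℝ) < ((m - 1).factorial : ℝ) := by exact_mod_cast (m - 1).factorial_pos
    have hY2 : (n : ℝ) ^ 2 ≤ Y := by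
      rw [hY, le_div_iff₀ hf0]
      calc (n : ℝ) ^ 2 * ((m - 1).factorial : ℝ) ≤ (n : ℝ) ^ 2 * (n : ℝ) ^ (m - 1) := by gcongr
        _ = (n : ℝ) ^ (m + 1) := by rw [← pow_add]; congr 1; omega
    have hff : ((m - 1).factorial : ℝ) ≤ m.factorial := by
      exact_mod_cast Nat.factorial_le (by omega)
    have hWY : W ≤ Real.exp 2 * (d * (4 + c)) * Y := by
      rw [hW, mul_assoc _ (n : ℝ)]
      gcongr
      rw [hY, ← mul_div_assoc, ← pow_succ']
      gcongr
    have hαY : α * n ≤ 3 * Y := by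
      have : α ≤ 3 * n := by
        rw [hα]; exact div_le_self (by positivity) (by linarith)
      have h1 : α * n ≤ 3 * n * n := mul_le_mul_of_nonneg_right this hn0.le
      linarith [sq (n : ℝ)]
    have hβY : β ≤ 4 * d * Y := by
      have h1 : β ≤ d * (4 * n) := by rw [hβe]; gcongr; linarith
      have h2 : d * (4 * n) ≤ d * (4 * Y) := by
        have h3 : (n : ℝ) ≤ n ^ 2 := le_self_pow₀ (by linarith) (by norm_num)
        gcongr
        linarith
      linarith
    linarith


/-- Runtime of the MMAHH with OI+AM on `Jump_m` for `q = 1/(d·m)`, `p = m·q/(c·n)`. -/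
theorem mmahh_oi_am_jump_q_small (c d : ℝ) (hc : 2 ≤ c) (hd : 1 ≤ d) :
    ∃ C : ℝ, 0 < C ∧
      ∀ (n m : ℕ), 3 ≤ n → 1 < m → 2 * m < n →
        ∀ (Ω : Type) [MeasurableSpace Ω] (μ : Measure Ω) (X : ℕ → Ω → Point n × Op),
          IsProbabilityMeasure μ →
          IsMMAHH μ X (Jump n m) ((m : ℝ) * (1 / (d * (m : ℝ))) / (c * (n : ℝ)))
            (1 / (d * (m : ℝ))) →
          (∀ x0 : Point n, μ {ω | X 0 ω = (x0, Op.OI)} = 1 / 2 ^ n) →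
          ∫⁻ ω, (hitTime X ω : ℝ≥0∞) ∂μ ≤
              ENNReal.ofReal (C * ((n : ℝ) ^ 2 +
                Real.exp (1 / d) * (n : ℝ) ^ (m + 1) / ((m - 1).factorial : ℝ))) ∧
          ∫⁻ ω, (hitTime X ω : ℝ≥0∞) ∂μ ≤
              ENNReal.ofReal (C * (n : ℝ) ^ (m + 1) / ((m - 1).factorial : ℝ)) := by
  refine ⟨Real.exp 2 * (d * (4 + c)) + 3 + 4 * d, by positivity, ?_⟩
  intro n m _ hm hmn Ω _ μ X hμ hM _
  have h := main_bound c d hc hd n m hm hmn Ω μ X hμ hM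
  refine ⟨h.trans (ENNReal.ofReal_le_ofReal ?_), by rwa [mul_div_assoc]⟩
  have h1 : 1 ≤ Real.exp (1 / d) := Real.one_le_exp (by positivity)
  have h2 : 0 ≤ (n : ℝ) ^ (m + 1) / ((m - 1).factorial : ℝ) := by positivity
  have h3 : (n : ℝ) ^ (m + 1) / ((m - 1).factorial : ℝ)
      ≤ (n : ℝ) ^ 2 + Real.exp (1 / d) * (n : ℝ) ^ (m + 1) / ((m - 1).factorial : ℝ) := by
    rw [mul_div_assoc]
    nlinarith [sq_nonneg (n : ℝ)]
  gcongr
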